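/- Combinatorial form of Proposition 4.3: For every constant ℓ there exist constants C and W such that every full binary tree T with n ≥ 2 nodes whose nodes are labelled from a set of ℓ labels admits a hierarchical definition P of width at most W, depth at most C·log₂ n, and with at most C·n/log₂ n pairwise inequivalent patterns. -/

import Mathlib

/-- A finite rooted ordered tree, given by its finite, prefix-closed set of node
positions; a position is the list of child directions from the root.  In a
`k`-ordered tree every node has, for each `i : Fin k`, at most one `i`-th child,
which is automatic in this representation. -/
structure PosTree (k : ℕ) where
  nodes : Finset (List (Fin k))
  root_mem : [] ∈ nodes
  prefix_closed : ∀ u v : List (Fin k), u <+: v → v ∈ nodes → u ∈ nodes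

/-- A pattern in a tree: either a subtree pattern (a single node) or a context
pattern (a pair of a node and a proper descendant). -/
inductive Pattern (k : ℕ) : Type
  | subtree : List (Fin k) → Pattern k
  | context : List (Fin k) → List (Fin k) → Pattern k
deriving DecidableEq

/-- Validity of a pattern in a tree `T`: the nodes belong to `T`, and for a
context pattern `(v,w)` the node `w` is a proper descendant of `v`. -/
def Pattern.Valid {k : ℕ} (T : PosTree k) : Pattern k → Prop
  | .subtree v => v ∈ T.nodes
  | .context v w => v ∈ T.nodes ∧ w ∈ T.nodes ∧ v <+: w ∧ v ≠ w

/-- The set `V[p]` of nodes covered by a pattern. -/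
def Pattern.cover {k : ℕ} (T : PosTree k) : Pattern k → Set (List (Fin k))
  | .subtree v => {u | u ∈ T.nodes ∧ v <+: u}
  | .context v w => {u | u ∈ T.nodes ∧ v <+: u ∧ ¬ w <+: u}

/-- A hierarchical definition of `T`: a well-nested set of valid patterns
containing the largest pattern (the root of `T`). -/
structure IsHierDef {k : ℕ} (T : PosTree k) (P : Finset (Pattern k)) : Prop where
  valid : ∀ p ∈ P, p.Valid T
  root_mem : Pattern.subtree ([] : List (Fin k)) ∈ P
  nested : ∀ p ∈ P, ∀ q ∈ P,
    Disjoint (p.cover T) (q.cover T) ∨ p.cover T ⊆ q.cover T ∨ q.cover T ⊆ p.cover T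

/-- `q` is a direct subpattern of `p` (with respect to `P`): `q < p` and no
`r ∈ P` lies strictly between them. -/
def DirectSub {k : ℕ} (T : PosTree k) (P : Finset (Pattern k))
    (q p : Pattern k) : Prop :=
  q ∈ P ∧ p ∈ P ∧ q.cover T ⊂ p.cover T ∧
    ∀ r ∈ P, ¬ (q.cover T ⊂ r.cover T ∧ r.cover T ⊂ p.cover T)

/-- The boundary `∂p`: the nodes covered by `p` but by no direct subpattern. -/
def boundary {k : ℕ} (T : PosTree k) (P : Finset (Pattern k)) (p : Pattern k) :
    Set (List (Fin k)) :=
  p.cover T \ ⋃ q ∈ {q | DirectSub T P q p}, q.cover T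

/-- The size of the branching tree of `p`: the number of boundary nodes plus the
number of direct subpatterns (each direct subpattern is contracted to a single
node). -/
noncomputable def branchSize {k : ℕ} (T : PosTree k) (P : Finset (Pattern k))
    (p : Pattern k) : ℕ :=
  (boundary T P p).ncard + {q | DirectSub T P q p}.ncard

/-- The width of `P` is at most `W`: every branching tree has size at most `W`. -/
def WidthLE {k : ℕ} (T : PosTree k) (P : Finset (Pattern k)) (W : ℕ) : Prop :=
  ∀ p ∈ P, branchSize T P p ≤ W

/-- The depth of `P` (the height of its pattern tree) is at most `d`: every
strictly decreasing chain of patterns of `P` has at most `d + 1` elements. -/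
def DepthLE {k : ℕ} (T : PosTree k) (P : Finset (Pattern k)) (d : ℕ) : Prop :=
  ∀ c : List (Pattern k), (∀ p ∈ c, p ∈ P) →
    c.Chain' (fun p q => q.cover T ⊂ p.cover T) → c.length ≤ d + 1

/-- Equivalence of two patterns `p₁, p₂ ∈ P` of a node-labelled tree: a label-
and order-preserving isomorphism between `(T[p₁], P[p₁])` and `(T[p₂], P[p₂])`,
i.e. a bijection of the covered node sets preserving labels and the `i`-th child
relation and mapping the subpatterns of `p₁` belonging to `P` onto those of
`p₂`. -/
def Equivalent {k ℓ : ℕ} (T : PosTree k) (label : List (Fin k) → Fin ℓ)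
    (P : Finset (Pattern k)) (p₁ p₂ : Pattern k) : Prop :=
  ∃ φ : List (Fin k) → List (Fin k),
    Set.BijOn φ (p₁.cover T) (p₂.cover T) ∧
    (∀ u ∈ p₁.cover T, label (φ u) = label u) ∧
    (∀ u ∈ p₁.cover T, ∀ v ∈ p₁.cover T, ∀ i : Fin k,
       (v = u ++ [i] ↔ φ v = φ u ++ [i])) ∧
    (∀ q ∈ P, q.cover T ⊆ p₁.cover T →
       ∃ q' ∈ P, q'.cover T ⊆ p₂.cover T ∧ φ '' q.cover T = q'.cover T) ∧
    (∀ q' ∈ P, q'.cover T ⊆ p₂.cover T →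
       ∃ q ∈ P, q.cover T ⊆ p₁.cover T ∧ φ '' q.cover T = q'.cover T)

/-- `P` has at most `m` pairwise inequivalent patterns: some set of at most `m`
patterns of `P` meets every equivalence class. -/
def InequivLE {k ℓ : ℕ} (T : PosTree k) (label : List (Fin k) → Fin ℓ)
    (P : Finset (Pattern k)) (m : ℕ) : Prop :=
  ∃ reps : Finset (Pattern k), reps ⊆ P ∧ reps.card ≤ m ∧
    ∀ p ∈ P, ∃ q ∈ reps, Equivalent T label P p q

/-- A full binary tree: every node has either no children or both children. -/
def PosTree.IsFullBinary (T : PosTree 2) : Prop :=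
  ∀ v ∈ T.nodes, ∀ i j : Fin 2, v ++ [i] ∈ T.nodes → v ++ [j] ∈ T.nodes

/-- Tree and context expressions. -/
inductive Ex (ℓ : ℕ) : Type
  | leaf : Fin ℓ → Ex ℓ
  | node : Fin ℓ → Ex ℓ → Ex ℓ → Ex ℓ
  | app : Ex ℓ → Ex ℓ → Ex ℓ
  | nodeL : Fin ℓ → Ex ℓ → Ex ℓ
  | nodeR : Fin ℓ → Ex ℓ → Ex ℓ
  | comp : Ex ℓ → Ex ℓ → Ex ℓ
deriving DecidableEq

namespace Ex
variable {ℓ : ℕ}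

/-- Number of constructors. -/
def size : Ex ℓ → ℕ
  | leaf _ => 1
  | node _ l r => 1 + size l + size r
  | app c t => 1 + size c + size t
  | nodeL _ e => 1 + size e
  | nodeR _ e => 1 + size e
  | comp c d => 1 + size c + size d

/-- Number of labelled constructors. -/
def wt : Ex ℓ → ℕ
  | leaf _ => 1
  | node _ l r => 1 + wt l + wt r
  | app c t => wt c + wt t
  | nodeL _ e => 1 + wt e
  | nodeR _ e => 1 + wt e
  | comp c d => wt c + wt d

/-- Height of an expression. -/
def dep : Ex ℓ → ℕ
  | leaf _ => 1
  | node _ l r => 1 + max (dep l) (dep r)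
  | app c t => 1 + max (dep c) (dep t)
  | nodeL _ e => 1 + dep e
  | nodeR _ e => 1 + dep e
  | comp c d => 1 + max (dep c) (dep d)

/-- Number of occurrences of subexpressions of size more than `M`. -/
def big (M : ℕ) : Ex ℓ → ℕ
  | leaf a => if size (leaf a) ≤ M then 0 else 1
  | node a l r => if size (node a l r) ≤ M then 0 else 1 + big M l + big M r
  | app c t => if size (app c t) ≤ M then 0 else 1 + big M c + big M t
  | nodeL a e => if size (nodeL a e) ≤ M then 0 else 1 + big M e
  | nodeR a e => if size (nodeR a e) ≤ M then 0 else 1 + big M e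
  | comp c d => if size (comp c d) ≤ M then 0 else 1 + big M c + big M d

/-- All subexpressions. -/
def subs : Ex ℓ → Finset (Ex ℓ)
  | leaf a => {leaf a}
  | node a l r => insert (node a l r) (subs l ∪ subs r)
  | app c t => insert (app c t) (subs c ∪ subs t)
  | nodeL a e => insert (nodeL a e) (subs e)
  | nodeR a e => insert (nodeR a e) (subs e)
  | comp c d => insert (comp c d) (subs c ∪ subs d)

theorem wt_pos (e : Ex ℓ) : 1 ≤ wt e := by
  induction e <;> simp only [wt] <;> omega

theorem size_le (e : Ex ℓ) : size e + 1 ≤ 2 * wt e := by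
  induction e <;> simp only [wt, size] <;> omega

theorem dep_le (e : Ex ℓ) : dep e ≤ size e := by
  induction e <;> simp only [dep, size] <;> omega

theorem big_of_small (M : ℕ) (e : Ex ℓ) (h : size e ≤ M) : big M e = 0 := by
  cases e <;> simp only [big, if_pos h]

theorem self_mem_subs (e : Ex ℓ) : e ∈ subs e := by
  cases e <;> simp [subs]

theorem size_subs (e : Ex ℓ) : ∀ f ∈ subs e, size f ≤ size e := by
  induction e with
  | leaf a => simp [subs]
  | node a l r h1 h2 =>
    intro f hf
    simp only [subs, Finset.mem_insert, Finset.mem_union] at hf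
    rcases hf with rfl | hf | hf
    · exact le_rfl
    · have := h1 f hf; simp only [size]; omega
    · have := h2 f hf; simp only [size]; omega
  | app l r h1 h2 =>
    intro f hf
    simp only [subs, Finset.mem_insert, Finset.mem_union] at hf
    rcases hf with rfl | hf | hf
    · exact le_rfl
    · have := h1 f hf; simp only [size]; omega
    · have := h2 f hf; simp only [size]; omega
  | comp l r h1 h2 =>
    intro f hf
    simp only [subs, Finset.mem_insert, Finset.mem_union] at hf
    rcases hf with rfl | hf | hf
    · exact le_rfl
    · have := h1 f hf; simp only [size]; omega
    · have := h2 f hf; simp only [size]; omega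
  | nodeL a l h1 =>
    intro f hf
    simp only [subs, Finset.mem_insert] at hf
    rcases hf with rfl | hf
    · exact le_rfl
    · have := h1 f hf; simp only [size]; omega
  | nodeR a l h1 =>
    intro f hf
    simp only [subs, Finset.mem_insert] at hf
    rcases hf with rfl | hf
    · exact le_rfl
    · have := h1 f hf; simp only [size]; omega

theorem card_big_insert (M : ℕ) (e : Ex ℓ) (A B : Finset (Ex ℓ)) (a b : ℕ)
    (ha : (A.filter (fun f => M < size f)).card ≤ a)
    (hb : (B.filter (fun f => M < size f)).card ≤ b) :
    ((insert e (A ∪ B)).filter (fun f => M < size f)).card ≤ 1 + a + b := by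
  rw [Finset.filter_insert, Finset.filter_union]
  have h2 := Finset.card_union_le (A.filter (fun f => M < size f)) (B.filter (fun f => M < size f))
  split_ifs
  · have h1 := Finset.card_insert_le e
      (A.filter (fun f => M < size f) ∪ B.filter (fun f => M < size f))
    omega
  · omega

theorem filter_small (M : ℕ) (e : Ex ℓ) (h : size e ≤ M) :
    ((subs e).filter (fun f => M < size f)).card ≤ 0 := by
  rw [Nat.le_zero, Finset.card_eq_zero, Finset.filter_eq_empty_iff]
  intro f hf
  have := size_subs e f hf
  omega

theorem card_big (M : ℕ) (e : Ex ℓ) :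
    ((subs e).filter (fun f => M < size f)).card ≤ big M e := by
  by_cases hs : size e ≤ M
  · rw [big_of_small M e hs]; exact filter_small M e hs
  induction e with
  | leaf a =>
    simp only [big, if_neg hs, subs]
    exact (Finset.card_filter_le _ _).trans (by simp)
  | node a l r h1 h2 =>
    simp only [big, if_neg hs, subs]
    apply card_big_insert
    · by_cases h : size l ≤ M
      · rw [big_of_small M l h]; exact filter_small M l h
      · exact h1 h
    · by_cases h : size r ≤ M
      · rw [big_of_small M r h]; exact filter_small M r h
      · exact h2 h
  | app l r h1 h2 =>
    simp only [big, if_neg hs, subs]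
    apply card_big_insert
    · by_cases h : size l ≤ M
      · rw [big_of_small M l h]; exact filter_small M l h
      · exact h1 h
    · by_cases h : size r ≤ M
      · rw [big_of_small M r h]; exact filter_small M r h
      · exact h2 h
  | comp l r h1 h2 =>
    simp only [big, if_neg hs, subs]
    apply card_big_insert
    · by_cases h : size l ≤ M
      · rw [big_of_small M l h]; exact filter_small M l h
      · exact h1 h
    · by_cases h : size r ≤ M
      · rw [big_of_small M r h]; exact filter_small M r h
      · exact h2 h
  | nodeL a l h1 =>
    simp only [big, if_neg hs, subs]
    have := card_big_insert M (nodeL a l) (subs l) ∅ (big M l) 0 (by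
      by_cases h : size l ≤ M
      · rw [big_of_small M l h]; exact filter_small M l h
      · exact h1 h) (by simp)
    simpa using this
  | nodeR a l h1 =>
    simp only [big, if_neg hs, subs]
    have := card_big_insert M (nodeR a l) (subs l) ∅ (big M l) 0 (by
      by_cases h : size l ≤ M
      · rw [big_of_small M l h]; exact filter_small M l h
      · exact h1 h) (by simp)
    simpa using this

/-- Prefix encoding of expressions. -/
def enc : Ex ℓ → List (Fin 6 × Option (Fin ℓ))
  | leaf a => [(0, some a)]
  | node a l r => (1, some a) :: (enc l ++ enc r)
  | app c t => (2, none) :: (enc c ++ enc t)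
  | nodeL a e => (3, some a) :: enc e
  | nodeR a e => (4, some a) :: enc e
  | comp c d => (5, none) :: (enc c ++ enc d)

theorem enc_length (e : Ex ℓ) : (enc e).length = size e := by
  induction e <;> simp only [enc, size, List.length_cons, List.length_append, List.length_nil] <;> omega

theorem enc_inj (e : Ex ℓ) : ∀ (f : Ex ℓ) (r s : List (Fin 6 × Option (Fin ℓ))),
    enc e ++ r = enc f ++ s → e = f ∧ r = s := by
  induction e with
  | leaf a =>
    intro f r s h
    cases f <;> simp [enc] at h
    simp [h]
  | node a x y h1 h2 =>
    intro f r s h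
    cases f <;> simp [enc] at h
    obtain ⟨rfl, h⟩ := h
    obtain ⟨e1, k1⟩ := h1 _ _ _ h
    obtain ⟨e2, k2⟩ := h2 _ _ _ k1
    exact ⟨by rw [e1, e2], k2⟩
  | app x y h1 h2 =>
    intro f r s h
    cases f <;> simp [enc] at h
    obtain ⟨e1, k1⟩ := h1 _ _ _ h
    obtain ⟨e2, k2⟩ := h2 _ _ _ k1
    exact ⟨by rw [e1, e2], k2⟩
  | comp x y h1 h2 =>
    intro f r s h
    cases f <;> simp [enc] at h
    obtain ⟨e1, k1⟩ := h1 _ _ _ h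
    obtain ⟨e2, k2⟩ := h2 _ _ _ k1
    exact ⟨by rw [e1, e2], k2⟩
  | nodeL a x h1 =>
    intro f r s h
    cases f <;> simp [enc] at h
    obtain ⟨rfl, h⟩ := h
    obtain ⟨e1, k1⟩ := h1 _ _ _ h
    exact ⟨by rw [e1], k1⟩
  | nodeR a x h1 =>
    intro f r s h
    cases f <;> simp [enc] at h
    obtain ⟨rfl, h⟩ := h
    obtain ⟨e1, k1⟩ := h1 _ _ _ h
    exact ⟨by rw [e1], k1⟩

theorem card_small (M : ℕ) (F : Finset (Ex ℓ)) (hF : ∀ e ∈ F, size e ≤ M) :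
    F.card ≤ (6 * (ℓ + 1) + 1) ^ M := by
  have h : F.card ≤ (Finset.univ : Finset (Fin M → Option (Fin 6 × Option (Fin ℓ)))).card := by
    apply Finset.card_le_card_of_injOn (fun (e : Ex ℓ) (i : Fin M) => (enc e)[(i : ℕ)]?)
    · intro e _; simp
    · intro e he f hf hef
      have h1 : enc e = enc f := by
        apply List.ext_getElem?
        intro i
        by_cases hi : i < M
        · exact congrFun hef ⟨i, hi⟩
        · rw [List.getElem?_eq_none, List.getElem?_eq_none]
          · rw [enc_length]; have := hF f hf; omega
          · rw [enc_length]; have := hF e he; omega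
      exact (enc_inj e f [] [] (by simp [h1])).1
  simpa using h

theorem card_subs (M : ℕ) (e : Ex ℓ) :
    (subs e).card ≤ big M e + (6 * (ℓ + 1) + 1) ^ M := by
  rw [← Finset.card_filter_add_card_filter_not (s := subs e) (fun f => M < size f)]
  apply Nat.add_le_add (card_big M e)
  apply card_small
  intro f hf
  simpa using (Finset.mem_filter.1 hf).2

end Ex
/-- The expression `e` sits at the pattern `p` of the labelled tree. -/
inductive Sits {ℓ : ℕ} (T : PosTree 2) (lab : List (Fin 2) → Fin ℓ) : Ex ℓ → Pattern 2 → Prop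
  | leaf (v : List (Fin 2)) : v ∈ T.nodes → v ++ [0] ∉ T.nodes → v ++ [1] ∉ T.nodes →
      Sits T lab (.leaf (lab v)) (.subtree v)
  | node (v : List (Fin 2)) (l r : Ex ℓ) : Sits T lab l (.subtree (v ++ [0])) →
      Sits T lab r (.subtree (v ++ [1])) → Sits T lab (.node (lab v) l r) (.subtree v)
  | app (v w : List (Fin 2)) (c t : Ex ℓ) : Sits T lab c (.context v w) →
      Sits T lab t (.subtree w) → Sits T lab (.app c t) (.subtree v)
  | nodeL (v : List (Fin 2)) (e : Ex ℓ) : v ++ [0] ∈ T.nodes → Sits T lab e (.subtree (v ++ [1])) →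
      Sits T lab (.nodeL (lab v) e) (.context v (v ++ [0]))
  | nodeR (v : List (Fin 2)) (e : Ex ℓ) : v ++ [1] ∈ T.nodes → Sits T lab e (.subtree (v ++ [0])) →
      Sits T lab (.nodeR (lab v) e) (.context v (v ++ [1]))
  | comp (v w x : List (Fin 2)) (c d : Ex ℓ) : Sits T lab c (.context v w) →
      Sits T lab d (.context w x) → Sits T lab (.comp c d) (.context v x)

/-- Plain labelled binary trees. -/
inductive BT (ℓ : ℕ) : Type
  | leaf : Fin ℓ → BT ℓ
  | node : Fin ℓ → BT ℓ → BT ℓ → BT ℓ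

/-- The trivial expression of a tree. -/
def BT.toE {ℓ : ℕ} : BT ℓ → Ex ℓ
  | .leaf a => .leaf a
  | .node a l r => .node a l.toE r.toE

/-- Cluster trees. -/
inductive CT (ℓ : ℕ) : Type
  | atom : Ex ℓ → CT ℓ
  | un : Ex ℓ → CT ℓ → CT ℓ
  | bin : Fin ℓ → CT ℓ → CT ℓ → CT ℓ

namespace CT
variable {ℓ : ℕ}

/-- The expression of a cluster tree. -/
def toE : CT ℓ → Ex ℓ
  | atom e => e
  | un c X => .app c X.toE
  | bin a X Y => .node a X.toE Y.toE

/-- Number of clusters. -/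
def num : CT ℓ → ℕ
  | atom _ => 1
  | un _ X => 1 + X.num
  | bin _ X Y => 1 + X.num + Y.num

/-- All clusters are small. -/
def Good (m : ℕ) : CT ℓ → Prop
  | atom e => e.wt ≤ m
  | un c X => c.wt ≤ m ∧ X.Good m
  | bin _ X Y => X.Good m ∧ Y.Good m

end CT

section
variable {ℓ : ℕ} (T : PosTree 2) (lab : List (Fin 2) → Fin ℓ)

/-- `f` can replace `e` at all subtree patterns. -/
def Refines (e f : Ex ℓ) : Prop :=
  ∀ v, Sits T lab e (.subtree v) → Sits T lab f (.subtree v)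

theorem refines_node {a : Fin ℓ} {l r l' r' : Ex ℓ} (h1 : Refines T lab l l')
    (h2 : Refines T lab r r') : Refines T lab (.node a l r) (.node a l' r') := by
  intro v h
  cases h with
  | node _ _ _ hl hr => exact .node _ _ _ (h1 _ hl) (h2 _ hr)

theorem Sits.mem {e : Ex ℓ} {p : Pattern 2} (h : Sits T lab e p) :
    match p with
    | .subtree v => v ∈ T.nodes
    | .context v w => v ∈ T.nodes ∧ w ∈ T.nodes := by
  induction h with
  | leaf v h => exact h
  | node v l r _ _ h1 _ => exact T.prefix_closed _ _ (List.prefix_append v [0]) h1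
  | app v w c t _ _ h1 _ => exact h1.1
  | nodeL v e h0 _ _ => exact ⟨T.prefix_closed _ _ (List.prefix_append v [0]) h0, h0⟩
  | nodeR v e h0 _ _ => exact ⟨T.prefix_closed _ _ (List.prefix_append v [1]) h0, h0⟩
  | comp v w x c d _ _ h1 h2 => exact ⟨h1.1, h2.2⟩

theorem refines_node_left {a : Fin ℓ} {l r : Ex ℓ} :
    Refines T lab (.node a l r) (.app (.nodeL a r) l) := by
  intro v h
  cases h with
  | node _ _ _ hl hr => exact .app v (v ++ [0]) _ _ (.nodeL v r (Sits.mem T lab hl) hr) hl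

theorem refines_node_right {a : Fin ℓ} {l r : Ex ℓ} :
    Refines T lab (.node a l r) (.app (.nodeR a l) r) := by
  intro v h
  cases h with
  | node _ _ _ hl hr => exact .app v (v ++ [1]) _ _ (.nodeR v l (Sits.mem T lab hr) hl) hr

theorem refines_app {c t t' : Ex ℓ} (h1 : Refines T lab t t') :
    Refines T lab (.app c t) (.app c t') := by
  intro v h
  cases h with
  | app _ w _ _ hc ht => exact .app _ w _ _ hc (h1 _ ht)

theorem refines_assoc {c d t : Ex ℓ} :
    Refines T lab (.app c (.app d t)) (.app (.comp c d) t) := by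
  intro v h
  cases h with
  | app _ w _ _ hc ht =>
    cases ht with
    | app _ x _ _ hd ht => exact .app _ x _ _ (.comp _ w _ _ _ hc hd) ht

theorem Refines.trans' {e f g : Ex ℓ} (h1 : Refines T lab e f) (h2 : Refines T lab f g) :
    Refines T lab e g := fun v h => h2 v (h1 v h)

/-- Clustering of a tree into small clusters. -/
theorem cluster (m : ℕ) (hm : 1 ≤ m) (t : BT ℓ) :
    t.toE.wt ≤ m ∨
    (∃ X : CT ℓ, X.Good m ∧ Refines T lab t.toE X.toE ∧ m * X.num + 3 * m ≤ 6 * t.toE.wt) ∨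
    (∃ (c : Ex ℓ) (X : CT ℓ), c.wt ≤ m ∧ X.Good m ∧ Refines T lab t.toE (.app c X.toE) ∧
      m * X.num + 3 * m + 6 * c.wt ≤ 6 * t.toE.wt) := by
  induction t with
  | leaf a => left; simpa [BT.toE, Ex.wt] using hm
  | node a l r hl hr =>
    have key : ∀ (e : Ex ℓ), (∃ X : CT ℓ, X.Good m ∧ Refines T lab e X.toE ∧
          m * X.num + 3 * m ≤ 6 * e.wt) ∨
        (∃ (c : Ex ℓ) (X : CT ℓ), c.wt ≤ m ∧ X.Good m ∧ Refines T lab e (.app c X.toE) ∧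
          m * X.num + 3 * m + 6 * c.wt ≤ 6 * e.wt) →
        ∃ X : CT ℓ, X.Good m ∧ Refines T lab e X.toE ∧ m * X.num + 2 * m ≤ 6 * e.wt := by
      rintro e (⟨X, h1, h2, h3⟩ | ⟨c, X, h0, h1, h2, h3⟩)
      · exact ⟨X, h1, h2, by omega⟩
      · refine ⟨.un c X, ⟨h0, h1⟩, h2, ?_⟩
        simp only [CT.num, Nat.mul_add, Nat.mul_one]; omega
    -- absorbing a small sibling `s` through the frame `g`
    have absorb : ∀ (e s g : Ex ℓ), s.wt ≤ m → g.wt = 1 + s.wt →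
        (∀ Y : Ex ℓ, Refines T lab e Y → Refines T lab (BT.node a l r).toE (.app g Y)) →
        (∀ X : CT ℓ, X.Good m → Refines T lab e X.toE → ∃ Z : CT ℓ, Z.Good m ∧
          Refines T lab (BT.node a l r).toE Z.toE ∧ Z.num = 2 + X.num) →
        (BT.node a l r).toE.wt = 1 + s.wt + e.wt →
        ((∃ X : CT ℓ, X.Good m ∧ Refines T lab e X.toE ∧
          m * X.num + 3 * m ≤ 6 * e.wt) ∨
        (∃ (c : Ex ℓ) (X : CT ℓ), c.wt ≤ m ∧ X.Good m ∧ Refines T lab e (.app c X.toE) ∧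
          m * X.num + 3 * m + 6 * c.wt ≤ 6 * e.wt)) →
        (∃ X : CT ℓ, X.Good m ∧ Refines T lab (BT.node a l r).toE X.toE ∧
          m * X.num + 3 * m ≤ 6 * (BT.node a l r).toE.wt) ∨
        (∃ (c : Ex ℓ) (X : CT ℓ), c.wt ≤ m ∧ X.Good m ∧
          Refines T lab (BT.node a l r).toE (.app c X.toE) ∧
          m * X.num + 3 * m + 6 * c.wt ≤ 6 * (BT.node a l r).toE.wt) := by
      intro e s g hs hg href hbin hw hcase
      rcases hcase with ⟨X, h1, h2, h3⟩ | ⟨c, X, h0, h1, h2, h3⟩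
      · by_cases hsm : 1 + s.wt ≤ m
        · right
          exact ⟨g, X, by omega, h1, href _ h2, by omega⟩
        · left
          obtain ⟨Z, z1, z2, z3⟩ := hbin X h1 h2
          refine ⟨Z, z1, z2, ?_⟩
          rw [z3, Nat.mul_add]; omega
      · by_cases hsm : 1 + s.wt + c.wt ≤ m
        · right
          refine ⟨.comp g c, X, by simp only [Ex.wt]; omega, h1,
            Refines.trans' T lab (href _ h2) (refines_assoc T lab), ?_⟩
          simp only [Ex.wt] at *; omega
        · left
          obtain ⟨Z, z1, z2, z3⟩ := hbin (.un c X) ⟨h0, h1⟩ h2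
          refine ⟨Z, z1, z2, ?_⟩
          rw [z3, CT.num, Nat.mul_add, Nat.mul_add]; omega
    rcases hl with hl | hl
    · rcases hr with hr | hr
      · by_cases hs : (BT.node a l r).toE.wt ≤ m
        · left; exact hs
        · right; left
          refine ⟨.bin a (.atom l.toE) (.atom r.toE), ⟨hl, hr⟩, fun v h => h, ?_⟩
          simp only [CT.num]; omega
      · right
        refine absorb r.toE l.toE (.nodeR a l.toE) hl rfl ?_ ?_ rfl hr
        · intro Y hY
          exact Refines.trans' T lab (refines_node_right T lab) (refines_app T lab hY)
        · intro X h1 h2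
          exact ⟨.bin a (.atom l.toE) X, ⟨hl, h1⟩, refines_node T lab (fun v h => h) h2,
            by simp only [CT.num]⟩
    · rcases hr with hr | hr
      · right
        refine absorb l.toE r.toE (.nodeL a r.toE) hr rfl ?_ ?_
          (by simp only [BT.toE, Ex.wt]; omega) hl
        · intro Y hY
          exact Refines.trans' T lab (refines_node_left T lab) (refines_app T lab hY)
        · intro X h1 h2
          exact ⟨.bin a X (.atom r.toE), ⟨h1, hr⟩, refines_node T lab h2 (fun v h => h),
            by simp only [CT.num]; omega⟩
      · right; left
        obtain ⟨X, x1, x2, x3⟩ := key _ hl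
        obtain ⟨Y, y1, y2, y3⟩ := key _ hr
        refine ⟨.bin a X Y, ⟨x1, y1⟩, refines_node T lab x2 y2, ?_⟩
        simp only [CT.num, BT.toE, Ex.wt, Nat.mul_add, Nat.mul_one]; omega

theorem cluster' (m : ℕ) (hm : 1 ≤ m) (t : BT ℓ) :
    ∃ X : CT ℓ, X.Good m ∧ Refines T lab t.toE X.toE ∧ m * X.num ≤ 6 * t.toE.wt + m := by
  rcases cluster T lab m hm t with h | ⟨X, h1, h2, h3⟩ | ⟨c, X, h0, h1, h2, h3⟩
  · exact ⟨.atom t.toE, h, fun v h => h, by simp only [CT.num]; omega⟩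
  · exact ⟨X, h1, h2, by omega⟩
  · refine ⟨.un c X, ⟨h0, h1⟩, h2, ?_⟩
    simp only [CT.num, Nat.mul_add, Nat.mul_one]; omega

/-- One-step contexts over cluster trees. -/
inductive Fr (ℓ : ℕ) : Type
  | un : Ex ℓ → Fr ℓ
  | L : Fin ℓ → CT ℓ → Fr ℓ
  | R : Fin ℓ → CT ℓ → Fr ℓ

/-- Number of clusters in a frame. -/
def Fr.num {ℓ : ℕ} : Fr ℓ → ℕ
  | .un _ => 1
  | .L _ X => 1 + X.num
  | .R _ X => 1 + X.num

/-- All clusters are small. -/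
def Fr.Good {ℓ : ℕ} (m : ℕ) : Fr ℓ → Prop
  | .un c => c.wt ≤ m
  | .L _ X => X.Good m
  | .R _ X => X.Good m

/-- Plug an expression into a frame. -/
def Fr.plug {ℓ : ℕ} : Fr ℓ → Ex ℓ → Ex ℓ
  | .un c, Y => .app c Y
  | .L a X, Y => .node a Y X.toE
  | .R a X, Y => .node a X.toE Y

/-- Total number of clusters of a list of frames. -/
def fnum {ℓ : ℕ} (fs : List (Fr ℓ)) : ℕ := (fs.map Fr.num).sum

/-- Plug an expression into a list of frames. -/
def fplug {ℓ : ℕ} (fs : List (Fr ℓ)) (Y : Ex ℓ) : Ex ℓ := fs.foldr Fr.plug Y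

/-- The expression `e` represents the list of frames. -/
def CRep (e : Ex ℓ) (fs : List (Fr ℓ)) : Prop :=
  ∀ (Y : Ex ℓ) v, Sits T lab (fplug fs Y) (.subtree v) →
    ∃ w, Sits T lab e (.context v w) ∧ Sits T lab Y (.subtree w)

theorem rep_comp {c d : Ex ℓ} {A B : List (Fr ℓ)} (h1 : CRep T lab c A) (h2 : CRep T lab d B) :
    CRep T lab (.comp c d) (A ++ B) := by
  intro Y v h
  have : fplug (A ++ B) Y = fplug A (fplug B Y) := by simp [fplug]
  rw [this] at h
  obtain ⟨w, hw, h⟩ := h1 _ _ h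
  obtain ⟨x, hx, h⟩ := h2 _ _ h
  exact ⟨x, .comp _ w _ _ _ hw hx, h⟩

theorem descend (s m : ℕ) (X : CT ℓ) (hX : X.Good m) (hs : s < X.num) :
    ∃ (fs : List (Fr ℓ)) (Y : CT ℓ), X.toE = fplug fs Y.toE ∧ Y.Good m ∧ (∀ f ∈ fs, f.Good m) ∧
      s < Y.num ∧ fnum fs + Y.num = X.num ∧
      (match Y with
        | .atom _ => True
        | .un _ Z => Z.num ≤ s
        | .bin _ Z W => Z.num ≤ s ∧ W.num ≤ s) := by
  induction X with
  | atom e => exact ⟨[], .atom e, rfl, hX, by simp, hs, by simp [fnum], trivial⟩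
  | un c X ih =>
    by_cases h : s < X.num
    · obtain ⟨fs, Y, h1, h2, h3, h4, h5, h6⟩ := ih hX.2 h
      refine ⟨.un c :: fs, Y, by simp [fplug, CT.toE, h1, Fr.plug], h2, ?_, h4, ?_, h6⟩
      · intro f hf
        rcases List.mem_cons.1 hf with rfl | hf
        · exact hX.1
        · exact h3 f hf
      · simp only [fnum, List.map_cons, List.sum_cons, Fr.num, CT.num] at *; omega
    · exact ⟨[], .un c X, rfl, hX, by simp, hs, by simp [fnum], by simpa using h⟩
  | bin a X Z ih1 ih2 =>
    by_cases h : s < X.num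
    · obtain ⟨fs, Y, h1, h2, h3, h4, h5, h6⟩ := ih1 hX.1 h
      refine ⟨.L a Z :: fs, Y, by simp [fplug, CT.toE, h1, Fr.plug], h2, ?_, h4, ?_, h6⟩
      · intro f hf
        rcases List.mem_cons.1 hf with rfl | hf
        · exact hX.2
        · exact h3 f hf
      · simp only [fnum, List.map_cons, List.sum_cons, Fr.num, CT.num] at *; omega
    · by_cases h' : s < Z.num
      · obtain ⟨fs, Y, h1, h2, h3, h4, h5, h6⟩ := ih2 hX.2 h'
        refine ⟨.R a X :: fs, Y, by simp [fplug, CT.toE, h1, Fr.plug], h2, ?_, h4, ?_, h6⟩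
        · intro f hf
          rcases List.mem_cons.1 hf with rfl | hf
          · exact hX.1
          · exact h3 f hf
        · simp only [fnum, List.map_cons, List.sum_cons, Fr.num, CT.num] at *; omega
      · exact ⟨[], .bin a X Z, rfl, hX, by simp, hs, by simp [fnum], by
          simp only [not_lt] at h h'; exact ⟨h, h'⟩⟩

theorem split_list (s : ℕ) (fs : List (Fr ℓ)) : ∀ pre, fs ≠ [] → pre ≤ s → pre + fnum fs ≤ 2 * s →
    ∃ A f B, fs = A ++ f :: B ∧ pre + fnum A ≤ s ∧ fnum B ≤ s := by
  induction fs with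
  | nil => intro pre h; exact absurd rfl h
  | cons f rest ih =>
    intro pre _ hp ht
    by_cases hr : fnum rest ≤ s
    · exact ⟨[], f, rest, rfl, by simpa [fnum] using hp, hr⟩
    · have e1 : fnum (f :: rest) = f.num + fnum rest := by simp [fnum]
      obtain ⟨A, g, B, h1, h2, h3⟩ := ih (pre + f.num) (by
        rintro rfl; simp [fnum] at hr) (by omega) (by omega)
      refine ⟨f :: A, g, B, by simp [h1], ?_, h3⟩
      have e2 : fnum (f :: A) = f.num + fnum A := by simp [fnum]
      omega

theorem CT.num_pos (X : CT ℓ) : 1 ≤ X.num := by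
  cases X <;> simp only [CT.num] <;> omega

theorem Ex.big_app (M : ℕ) (c t : Ex ℓ) : (Ex.app c t).big M ≤ 1 + c.big M + t.big M := by
  simp only [Ex.big]; split_ifs <;> omega

theorem Ex.big_comp (M : ℕ) (c t : Ex ℓ) : (Ex.comp c t).big M ≤ 1 + c.big M + t.big M := by
  simp only [Ex.big]; split_ifs <;> omega

theorem Ex.big_node (M : ℕ) (a : Fin ℓ) (c t : Ex ℓ) :
    (Ex.node a c t).big M ≤ 1 + c.big M + t.big M := by
  simp only [Ex.big]; split_ifs <;> omega

theorem Ex.big_nodeL (M : ℕ) (a : Fin ℓ) (c : Ex ℓ) :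
    (Ex.nodeL a c).big M ≤ 1 + c.big M := by
  simp only [Ex.big]; split_ifs <;> omega

theorem Ex.big_nodeR (M : ℕ) (a : Fin ℓ) (c : Ex ℓ) :
    (Ex.nodeR a c).big M ≤ 1 + c.big M := by
  simp only [Ex.big]; split_ifs <;> omega

/-- Small atoms have small depth and no big subexpressions. -/
theorem atom_bounds (m : ℕ) (e : Ex ℓ) (h : e.wt ≤ m) : e.dep ≤ 2 * m ∧ e.big (2 * m) = 0 := by
  have h1 := Ex.size_le e
  have h2 := Ex.dep_le e
  exact ⟨by omega, Ex.big_of_small _ _ (by omega)⟩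

/-- Balanced expressions for lists of frames, given those for trees and for half-size lists. -/
theorem balance_ctx (m s D : ℕ)
    (ht : ∀ X : CT ℓ, X.Good m → X.num ≤ 2 * s → ∃ e, Refines T lab X.toE e ∧ e.dep ≤ D ∧
      e.big (2 * m) + 1 ≤ 2 * X.num)
    (hD : 2 * m ≤ D)
    (hc : ∀ fs : List (Fr ℓ), fs ≠ [] → (∀ f ∈ fs, f.Good m) → fnum fs ≤ s →
      ∃ e, CRep T lab e fs ∧ e.dep ≤ D + 1 ∧ e.big (2 * m) + 1 ≤ 2 * fnum fs)
    (fs : List (Fr ℓ)) (hne : fs ≠ []) (hg : ∀ f ∈ fs, f.Good m) (hn : fnum fs ≤ 2 * s) :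
    ∃ e, CRep T lab e fs ∧ e.dep ≤ D + 3 ∧ e.big (2 * m) + 1 ≤ 2 * fnum fs := by
  obtain ⟨A, f, B, rfl, hA, hB⟩ := split_list s fs 0 hne (by omega) (by omega)
  have hsum : fnum (A ++ f :: B) = fnum A + (f.num + fnum B) := by simp [fnum]
  have hgf : f.Good m := hg f (by simp)
  -- the middle frame
  have hf : ∃ e, CRep T lab e [f] ∧ e.dep ≤ D + 1 ∧ e.big (2 * m) + 1 ≤ 2 * f.num := by
    cases f with
    | un c =>
      obtain ⟨b1, b2⟩ := atom_bounds m c hgf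
      refine ⟨c, ?_, by omega, by simp only [Fr.num]; omega⟩
      intro Y v h
      cases h with
      | app _ w _ _ h1 h2 => exact ⟨w, h1, h2⟩
    | L a X =>
      simp only [Fr.num] at hsum
      obtain ⟨e, e1, e2, e3⟩ := ht X hgf (by omega)
      refine ⟨.nodeL a e, ?_, by simp only [Ex.dep]; omega, ?_⟩
      · intro Y v h
        cases h with
        | node _ _ _ h1 h2 => exact ⟨_, .nodeL v e (Sits.mem T lab h1) (e1 _ h2), h1⟩
      · have := Ex.big_nodeL (2 * m) a e
        simp only [Fr.num]; omega
    | R a X =>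
      simp only [Fr.num] at hsum
      obtain ⟨e, e1, e2, e3⟩ := ht X hgf (by omega)
      refine ⟨.nodeR a e, ?_, by simp only [Ex.dep]; omega, ?_⟩
      · intro Y v h
        cases h with
        | node _ _ _ h1 h2 => exact ⟨_, .nodeR v e (Sits.mem T lab h2) (e1 _ h1), h2⟩
      · have := Ex.big_nodeR (2 * m) a e
        simp only [Fr.num]; omega
  obtain ⟨e, e1, e2, e3⟩ := hf
  have hfB : ∃ e, CRep T lab e (f :: B) ∧ e.dep ≤ D + 2 ∧
      e.big (2 * m) + 1 ≤ 2 * (f.num + fnum B) := by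
    by_cases hB0 : B = []
    · subst hB0
      exact ⟨e, e1, by omega, by omega⟩
    · obtain ⟨d, d1, d2, d3⟩ := hc B hB0 (fun g hgB => hg g (by simp [hgB])) hB
      refine ⟨.comp e d, rep_comp T lab e1 d1, by simp only [Ex.dep]; omega, ?_⟩
      have := Ex.big_comp (2 * m) e d
      omega
  obtain ⟨k, k1, k2, k3⟩ := hfB
  by_cases hA0 : A = []
  · subst hA0
    exact ⟨k, k1, by omega, by omega⟩
  · obtain ⟨d, d1, d2, d3⟩ := hc A hA0 (fun g hgB => hg g (by simp [hgB])) (by omega)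
    refine ⟨.comp d k, rep_comp T lab d1 k1, by simp only [Ex.dep]; omega, ?_⟩
    have := Ex.big_comp (2 * m) d k
    omega

theorem balance_tree (m s D : ℕ)
    (ht : ∀ X : CT ℓ, X.Good m → X.num ≤ s → ∃ e, Refines T lab X.toE e ∧ e.dep ≤ D ∧
      e.big (2 * m) + 1 ≤ 2 * X.num)
    (hD : 2 * m ≤ D)
    (hc : ∀ fs : List (Fr ℓ), fs ≠ [] → (∀ f ∈ fs, f.Good m) → fnum fs ≤ s →
      ∃ e, CRep T lab e fs ∧ e.dep ≤ D + 3 ∧ e.big (2 * m) + 1 ≤ 2 * fnum fs)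
    (X : CT ℓ) (hg : X.Good m) (hn : X.num ≤ 2 * s) :
    ∃ e, Refines T lab X.toE e ∧ e.dep ≤ D + 4 ∧ e.big (2 * m) + 1 ≤ 2 * X.num := by
  by_cases hs : X.num ≤ s
  · obtain ⟨e, e1, e2, e3⟩ := ht X hg hs
    exact ⟨e, e1, by omega, e3⟩
  obtain ⟨fs, Y, h1, h2, h3, h4, h5, h6⟩ := descend s m X hg (by omega)
  have hY : ∃ e, Refines T lab Y.toE e ∧ e.dep ≤ D + 1 ∧ e.big (2 * m) + 1 ≤ 2 * Y.num := by
    cases Y with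
    | atom e =>
      obtain ⟨b1, b2⟩ := atom_bounds m e h2
      exact ⟨e, fun v h => h, by omega, by simp only [CT.num]; omega⟩
    | un c Z =>
      obtain ⟨b1, b2⟩ := atom_bounds m c h2.1
      obtain ⟨e, e1, e2, e3⟩ := ht Z h2.2 h6
      refine ⟨.app c e, refines_app T lab e1, by simp only [Ex.dep]; omega, ?_⟩
      have := Ex.big_app (2 * m) c e
      simp only [CT.num]; omega
    | bin a Z W =>
      obtain ⟨e, e1, e2, e3⟩ := ht Z h2.1 h6.1
      obtain ⟨f, f1, f2, f3⟩ := ht W h2.2 h6.2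
      refine ⟨.node a e f, refines_node T lab e1 f1, by simp only [Ex.dep]; omega, ?_⟩
      have := Ex.big_node (2 * m) a e f
      simp only [CT.num]; omega
  obtain ⟨e, e1, e2, e3⟩ := hY
  by_cases hf : fs = []
  · subst hf
    rw [h1]
    exact ⟨e, e1, by omega, by simp [fnum] at h5; omega⟩
  · obtain ⟨c, c1, c2, c3⟩ := hc fs hf h3 (by omega)
    refine ⟨.app c e, ?_, by simp only [Ex.dep]; omega, ?_⟩
    · rw [h1]
      intro v h
      obtain ⟨w, hw, h⟩ := c1 _ _ h
      exact .app _ w _ _ hw (e1 _ h)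
    · have := Ex.big_app (2 * m) c e
      omega

theorem balance (m k : ℕ) :
    (∀ X : CT ℓ, X.Good m → X.num ≤ 2 ^ k → ∃ e, Refines T lab X.toE e ∧
      e.dep ≤ 4 * k + 2 * m ∧ e.big (2 * m) + 1 ≤ 2 * X.num) ∧
    (∀ fs : List (Fr ℓ), fs ≠ [] → (∀ f ∈ fs, f.Good m) → fnum fs ≤ 2 ^ k →
      ∃ e, CRep T lab e fs ∧ e.dep ≤ 4 * k + 2 * m + 3 ∧ e.big (2 * m) + 1 ≤ 2 * fnum fs) := by
  induction k with
  | zero =>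
    have ht : ∀ X : CT ℓ, X.Good m → X.num ≤ 1 → ∃ e, Refines T lab X.toE e ∧
        e.dep ≤ 2 * m ∧ e.big (2 * m) + 1 ≤ 2 * X.num := by
      intro X hg hn
      cases X with
      | atom e =>
        obtain ⟨b1, b2⟩ := atom_bounds m e hg
        exact ⟨e, fun v h => h, by omega, by simp only [CT.num]; omega⟩
      | un c Z => have := Z.num_pos; simp only [CT.num] at hn; omega
      | bin a Z W => have := Z.num_pos; simp only [CT.num] at hn; omega
    constructor
    · simpa using ht
    · intro fs hne hg hn
      simp only [pow_zero] at hn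
      match fs, hne, hg, hn with
      | f :: rest, _, hg, hn =>
        have e1 : fnum (f :: rest) = f.num + fnum rest := by simp [fnum]
        have hrest : rest = [] := by
          match rest, e1 with
          | [], _ => rfl
          | g :: r, e1 =>
            exfalso
            have e2 : fnum (g :: r) = g.num + fnum r := by simp [fnum]
            have : 1 ≤ f.num := by cases f <;> simp only [Fr.num] <;> omega
            have : 1 ≤ g.num := by cases g <;> simp only [Fr.num] <;> omega
            omega
        subst hrest
        cases f with
        | un c =>
          obtain ⟨b1, b2⟩ := atom_bounds m c (hg (.un c) (by simp))
          refine ⟨c, ?_, by omega, by simp only [Fr.num] at e1; omega⟩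
          intro Y v h
          cases h with
          | app _ w _ _ h1 h2 => exact ⟨w, h1, h2⟩
        | L a X => have := X.num_pos; simp only [Fr.num] at e1; omega
        | R a X => have := X.num_pos; simp only [Fr.num] at e1; omega
  | succ k ih =>
    have e : 2 ^ (k + 1) = 2 * 2 ^ k := by ring
    have ht := balance_tree T lab m (2 ^ k) (4 * k + 2 * m) ih.1 (by omega) ih.2
    have hc := balance_ctx T lab m (2 ^ k) (4 * (k + 1) + 2 * m)
      (fun X h1 h2 => by
        obtain ⟨e, e1, e2, e3⟩ := ht X h1 h2
        exact ⟨e, e1, by omega, e3⟩) (by omega)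
      (fun fs h1 h2 h3 => by
        obtain ⟨e, e1, e2, e3⟩ := ih.2 fs h1 h2 h3
        exact ⟨e, e1, by omega, e3⟩)
    rw [e]
    exact ⟨fun X h1 h2 => by
        obtain ⟨e, e1, e2, e3⟩ := ht X h1 h2
        exact ⟨e, e1, by omega, e3⟩, hc⟩

end
section
variable {ℓ : ℕ} (T : PosTree 2)

/-- Abstract derivations of a set of patterns from an expression. -/
inductive Der (G : Ex ℓ → Pattern 2 → Finset (Pattern 2) → Prop) :
    Ex ℓ → Pattern 2 → Finset (Pattern 2) → Prop
  | mk (e : Ex ℓ) (p : Pattern 2) (S : Finset (Pattern 2)) (x : List (Fin 2))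
      (k : ℕ) (es : Fin k → Ex ℓ) (ps : Fin k → Pattern 2) (Ss : Fin k → Finset (Pattern 2)) :
      (∀ i, Der G (es i) (ps i) (Ss i)) → k ≤ 2 → G e p S → (p.cover T).Nonempty →
      (∀ q, q ∈ S ↔ q = p ∨ ∃ i, q ∈ Ss i) →
      (∀ u ∈ p.cover T, u = x ∨ ∃ i, u ∈ (ps i).cover T) →
      (∀ i, (ps i).cover T ⊂ p.cover T) →
      (∀ i j, i ≠ j → Disjoint ((ps i).cover T) ((ps j).cover T)) →
      (∀ i, (es i).dep + 1 ≤ e.dep) → 1 ≤ e.dep →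
      (∀ i, (es i).subs ⊆ e.subs) → Der G e p S

variable {G : Ex ℓ → Pattern 2 → Finset (Pattern 2) → Prop}
variable {T} {e : Ex ℓ} {p : Pattern 2} {S : Finset (Pattern 2)}

theorem Der.spec (h : Der T G e p S) : G e p S := by
  cases h; assumption

theorem Der.self_mem (h : Der T G e p S) : p ∈ S := by
  cases h with
  | mk _ _ _ x k es ps Ss hd hk hG hne hS => exact (hS p).2 (Or.inl rfl)

theorem Der.sub (h : Der T G e p S) : ∀ q ∈ S, (q.cover T).Nonempty ∧ q.cover T ⊆ p.cover T ∧
    (q = p ∨ q.cover T ⊂ p.cover T) := by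
  induction h with
  | mk e p S x k es ps Ss hd hk hG hne hS hb hss hdis hdep hdep1 hsubs ih =>
    intro q hq
    rcases (hS q).1 hq with rfl | ⟨i, hi⟩
    · exact ⟨hne, subset_rfl, Or.inl rfl⟩
    · obtain ⟨h1, h2, _⟩ := ih i q hi
      have := lt_of_le_of_lt h2 (hss i)
      exact ⟨h1, this.le, Or.inr this⟩

theorem Der.nested (h : Der T G e p S) : ∀ q ∈ S, ∀ r ∈ S,
    Disjoint (q.cover T) (r.cover T) ∨ q.cover T ⊆ r.cover T ∨ r.cover T ⊆ q.cover T := by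
  have hsub := h.sub
  induction h with
  | mk e p S x k es ps Ss hd hk hG hne hS hb hss hdis hdep hdep1 hsubs ih =>
    intro q hq r hr
    rcases (hS q).1 hq with rfl | ⟨i, hi⟩
    · exact Or.inr (Or.inr (hsub r hr).2.1)
    · rcases (hS r).1 hr with rfl | ⟨j, hj⟩
      · exact Or.inr (Or.inl (hsub q hq).2.1)
      · by_cases hij : i = j
        · subst hij
          exact ih i (hd i).sub q hi r hj
        · left
          exact (hdis i j hij).mono ((hd i).sub q hi).2.1 ((hd j).sub r hj).2.1

theorem not_le_disj {A B C D : Set (List (Fin 2))} (hA : A.Nonempty) (hAB : A ⊆ B) (hAC : A ⊆ C)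
    (hCD : C ⊆ D) (hd : Disjoint B D) : False := by
  obtain ⟨x, hx⟩ := hA
  exact Set.disjoint_left.1 hd (hAB hx) (hCD (hAC hx))

theorem Der.loc (h : Der T G e p S) : ∀ q ∈ S, ∃ e' ∈ e.subs, ∃ S', S' ⊆ S ∧ Der T G e' q S' ∧
    ∀ r ∈ S, r.cover T ⊆ q.cover T → r ∈ S' := by
  have hh := h
  induction h with
  | mk e p S x k es ps Ss hd hk hG hne hS hb hss hdis hdep hdep1 hsubs ih =>
    intro q hq
    rcases (hS q).1 hq with rfl | ⟨i, hi⟩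
    · exact ⟨e, Ex.self_mem_subs e, S, subset_rfl, hh, fun r hr _ => hr⟩
    · obtain ⟨e', he', S', h1, h2, h3⟩ := ih i (hd i) q hi
      refine ⟨e', hsubs i he', S', fun r hr => (hS r).2 (Or.inr ⟨i, h1 hr⟩), h2, ?_⟩
      intro r hr hrq
      have hqi := ((hd i).sub q hi).2.1
      rcases (hS r).1 hr with rfl | ⟨j, hj⟩
      · exact absurd (hrq.trans hqi) (hss i).2
      · by_cases hij : i = j
        · subst hij
          exact h3 r hj hrq
        · obtain ⟨r1, r2, _⟩ := (hd j).sub r hj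
          exact (not_le_disj r1 r2 hrq hqi (hdis j i (Ne.symm hij))).elim

theorem Der.width (h : Der T G e p S) (P : Finset (Pattern 2)) (hSP : S ⊆ P)
    (hP : ∀ r ∈ P, r.cover T ⊆ p.cover T → r ∈ S) : branchSize T P p ≤ 3 := by
  have hpS := h.self_mem
  cases h with
  | mk _ _ _ x k es ps Ss hd hk hG hne hS hb hss hdis hdep hdep1 hsubs =>
    have hmem : ∀ i, ps i ∈ S := fun i => (hS _).2 (Or.inr ⟨i, (hd i).self_mem⟩)
    have hdir : ∀ i, DirectSub T P (ps i) p := by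
      intro i
      refine ⟨hSP (hmem i), hSP hpS, hss i, ?_⟩
      rintro r hr ⟨h1, h2⟩
      have hrS := hP r hr h2.1
      rcases (hS r).1 hrS with rfl | ⟨j, hj⟩
      · exact h2.2 subset_rfl
      · have hrj := ((hd j).sub r hj).2.1
        by_cases hij : i = j
        · subst hij
          exact h1.2 hrj
        · obtain ⟨r1, _, _⟩ := (hd i).sub _ (hd i).self_mem
          exact not_le_disj r1 subset_rfl h1.1 hrj (hdis i j hij)
    have hsub : {q | DirectSub T P q p} ⊆ ((Finset.univ.image ps : Finset (Pattern 2)) : Set _) := by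
      rintro q ⟨hq, _, h1, h2⟩
      have hqS := hP q hq h1.1
      rcases (hS q).1 hqS with rfl | ⟨j, hj⟩
      · exact absurd subset_rfl h1.2
      · rcases ((hd j).sub q hj).2.2 with rfl | hlt
        · simp
        · exact (h2 (ps j) (hSP (hmem j)) ⟨hlt, hss j⟩).elim
    have hc : {q | DirectSub T P q p}.ncard ≤ 2 := by
      refine (Set.ncard_le_ncard hsub (Finset.finite_toSet _)).trans ?_
      rw [Set.ncard_coe_finset]
      refine Finset.card_image_le.trans ?_
      simpa using hk
    have hbd : boundary T P p ⊆ {x} := by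
      rintro u ⟨hu, hn⟩
      rcases hb u hu with rfl | ⟨i, hi⟩
      · rfl
      · exact (hn (Set.mem_biUnion (hdir i) hi)).elim
    have hb1 : (boundary T P p).ncard ≤ 1 := by
      have := Set.ncard_le_ncard hbd (Set.finite_singleton x)
      simpa using this
    unfold branchSize
    omega

theorem Der.depth (h : Der T G e p S) : ∀ c : List (Pattern 2), (∀ q ∈ c, q ∈ S) →
    c.IsChain (fun p q => q.cover T ⊂ p.cover T) → c.length ≤ e.dep := by
  have hh := h
  induction h with
  | mk e p S x k es ps Ss hd hk hG hne hS hb hss hdis hdep hdep1 hsubs ih =>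
    intro c hc hch
    match c, hc, hch with
    | [], _, _ => simp
    | [a], _, _ => simpa using hdep1
    | a :: b :: rest, hc, hch =>
      have htr : IsTrans (Pattern 2) (fun p q => q.cover T ⊂ p.cover T) :=
        ⟨fun a b c h1 h2 => lt_trans h2 h1⟩
      have hab : b.cover T ⊂ a.cover T := by
        rw [List.isChain_cons_cons] at hch; exact hch.1
      have hch' := (List.isChain_cons_cons.1 hch).2
      have hpw := List.isChain_iff_pairwise.1 hch'
      have ha := (hh.sub a (hc a (by simp))).2.1
      rcases (hS b).1 (hc b (by simp)) with rfl | ⟨i, hi⟩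
      · exact absurd ha hab.2
      · have hbi := ((hd i).sub b hi).2.1
        have : (b :: rest).length ≤ (es i).dep := by
          refine ih i (hd i) _ ?_ hch'
          intro q hq
          rcases List.mem_cons.1 hq with rfl | hq'
          · exact hi
          · have hqb : q.cover T ⊂ b.cover T := (List.pairwise_cons.1 hpw).1 q hq'
            rcases (hS q).1 (hc q (by simp [hq'])) with rfl | ⟨j, hj⟩
            · exact absurd (hbi.trans (hss i).1) hqb.2
            · by_cases hij : i = j
              · subst hij; exact hj
              · obtain ⟨r1, r2, _⟩ := (hd j).sub q hj
                exact (not_le_disj r1 r2 hqb.1 hbi (hdis j i (Ne.symm hij))).elim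
        have := hdep i
        simp only [List.length_cons] at *
        omega

end

/-- The relative hole position of a context expression. -/
def Ex.hole {ℓ : ℕ} : Ex ℓ → List (Fin 2)
  | .leaf _ => []
  | .node _ _ _ => []
  | .app _ _ => []
  | .nodeL _ _ => [0]
  | .nodeR _ _ => [1]
  | .comp c d => c.hole ++ d.hole

/-- The patterns of an expression rooted at `v`. -/
def Ex.pats {ℓ : ℕ} : Ex ℓ → List (Fin 2) → Finset (Pattern 2)
  | .leaf _, v => {.subtree v}
  | .node _ l r, v => insert (.subtree v) (l.pats (v ++ [0]) ∪ r.pats (v ++ [1]))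
  | .app c t, v => insert (.subtree v) (c.pats v ∪ t.pats (v ++ c.hole))
  | .nodeL _ e, v => insert (.context v (v ++ [0])) (e.pats (v ++ [1]))
  | .nodeR _ e, v => insert (.context v (v ++ [1])) (e.pats (v ++ [0]))
  | .comp c d, v => insert (.context v (v ++ (c.hole ++ d.hole))) (c.pats v ∪ d.pats (v ++ c.hole))

/-- The labelled relative cover of an expression. -/
def Ex.rc {ℓ : ℕ} : Ex ℓ → List (Fin 2) → Fin ℓ → Prop
  | .leaf a, x, b => x = [] ∧ a = b
  | .node a l r, x, b => (x = [] ∧ a = b) ∨ (∃ y, x = [0] ++ y ∧ l.rc y b) ∨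
      (∃ y, x = [1] ++ y ∧ r.rc y b)
  | .app c t, x, b => c.rc x b ∨ ∃ y, x = c.hole ++ y ∧ t.rc y b
  | .nodeL a e, x, b => (x = [] ∧ a = b) ∨ (∃ y, x = [1] ++ y ∧ e.rc y b)
  | .nodeR a e, x, b => (x = [] ∧ a = b) ∨ (∃ y, x = [0] ++ y ∧ e.rc y b)
  | .comp c t, x, b => c.rc x b ∨ ∃ y, x = c.hole ++ y ∧ t.rc y b

/-- Translate a pattern. -/
def Pattern.sh (v : List (Fin 2)) : Pattern 2 → Pattern 2
  | .subtree u => .subtree (v ++ u)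
  | .context u w => .context (v ++ u) (v ++ w)

/-- The top node of a pattern. -/
def Pattern.top : Pattern 2 → List (Fin 2)
  | .subtree u => u
  | .context u _ => u

theorem Ex.pats_sh {ℓ : ℕ} (e : Ex ℓ) (v : List (Fin 2)) : ∀ u,
    e.pats (v ++ u) = (e.pats u).image (Pattern.sh v) := by
  induction e with
  | leaf a => intro u; simp [Ex.pats, Pattern.sh]
  | node a l r h1 h2 =>
    intro u
    simp only [Ex.pats, Finset.image_insert, Finset.image_union, ← h1, ← h2, Pattern.sh,
      List.append_assoc]
  | app l r h1 h2 =>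
    intro u
    simp only [Ex.pats, Finset.image_insert, Finset.image_union, ← h1, ← h2, Pattern.sh,
      List.append_assoc]
  | comp l r h1 h2 =>
    intro u
    simp only [Ex.pats, Finset.image_insert, Finset.image_union, ← h1, ← h2, Pattern.sh,
      List.append_assoc]
  | nodeL a l h1 =>
    intro u
    simp only [Ex.pats, Finset.image_insert, ← h1, Pattern.sh, List.append_assoc]
  | nodeR a l h1 =>
    intro u
    simp only [Ex.pats, Finset.image_insert, ← h1, Pattern.sh, List.append_assoc]

section
variable {ℓ : ℕ} (T : PosTree 2) (lab : List (Fin 2) → Fin ℓ)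

theorem app_eq_left (v x : List (Fin 2)) : v ++ x = v ↔ x = [] := by
  simp

theorem pre_cases (v u : List (Fin 2)) :
    v <+: u ↔ u = v ∨ v ++ [0] <+: u ∨ v ++ [1] <+: u := by
  constructor
  · rintro ⟨x, rfl⟩
    match x with
    | [] => simp
    | i :: y =>
      right
      fin_cases i
      · left; exact ⟨y, by simp⟩
      · right; exact ⟨y, by simp⟩
  · rintro (rfl | h | h)
    · exact List.prefix_rfl
    · exact (List.prefix_append _ _).trans h
    · exact (List.prefix_append _ _).trans h

theorem pre_disj (v u : List (Fin 2)) (h0 : v ++ [0] <+: u) (h1 : v ++ [1] <+: u) : False := by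
  obtain ⟨x, rfl⟩ := h0
  obtain ⟨y, hy⟩ := h1
  simp at hy

theorem not_pre_self (v : List (Fin 2)) (i : Fin 2) : ¬ v ++ [i] <+: v := by
  intro h
  have := h.length_le
  simp at this

theorem cover_node (v : List (Fin 2)) (hv : v ∈ T.nodes) (u : List (Fin 2)) :
    u ∈ (Pattern.subtree v).cover T ↔ u = v ∨ u ∈ (Pattern.subtree (v ++ [0])).cover T ∨
      u ∈ (Pattern.subtree (v ++ [1])).cover T := by
  simp only [Pattern.cover, Set.mem_ofPred_eq]
  rw [pre_cases v u]
  constructor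
  · tauto
  · rintro (rfl | h | h) <;> tauto

theorem cover_nodeL (v : List (Fin 2)) (hv : v ∈ T.nodes) (u : List (Fin 2)) :
    u ∈ (Pattern.context v (v ++ [0])).cover T ↔ u = v ∨
      u ∈ (Pattern.subtree (v ++ [1])).cover T := by
  simp only [Pattern.cover, Set.mem_ofPred_eq]
  rw [pre_cases v u]
  have h1 := pre_disj v u
  constructor
  · tauto
  · rintro (rfl | h)
    · exact ⟨hv, Or.inl rfl, not_pre_self _ _⟩
    · tauto

theorem cover_nodeR (v : List (Fin 2)) (hv : v ∈ T.nodes) (u : List (Fin 2)) :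
    u ∈ (Pattern.context v (v ++ [1])).cover T ↔ u = v ∨
      u ∈ (Pattern.subtree (v ++ [0])).cover T := by
  simp only [Pattern.cover, Set.mem_ofPred_eq]
  rw [pre_cases v u]
  have h1 := pre_disj v u
  constructor
  · tauto
  · rintro (rfl | h)
    · exact ⟨hv, Or.inl rfl, not_pre_self _ _⟩
    · tauto

theorem cover_app (v w : List (Fin 2)) (hvw : v <+: w) (u : List (Fin 2)) :
    u ∈ (Pattern.subtree v).cover T ↔ u ∈ (Pattern.context v w).cover T ∨
      u ∈ (Pattern.subtree w).cover T := by
  simp only [Pattern.cover, Set.mem_ofPred_eq]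
  have : w <+: u → v <+: u := hvw.trans
  tauto

theorem cover_comp (v w x : List (Fin 2)) (hvw : v <+: w) (hwx : w <+: x) (u : List (Fin 2)) :
    u ∈ (Pattern.context v x).cover T ↔ u ∈ (Pattern.context v w).cover T ∨
      u ∈ (Pattern.context w x).cover T := by
  simp only [Pattern.cover, Set.mem_ofPred_eq]
  have : w <+: u → v <+: u := hvw.trans
  have : x <+: u → w <+: u := hwx.trans
  tauto

theorem disj_app (v w : List (Fin 2)) :
    Disjoint ((Pattern.context v w).cover T) ((Pattern.subtree w).cover T) := by
  rw [Set.disjoint_left]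
  rintro u ⟨_, _, h⟩ ⟨_, h'⟩
  exact h h'

theorem disj_comp (v w x : List (Fin 2)) :
    Disjoint ((Pattern.context v w).cover T) ((Pattern.context w x).cover T) := by
  rw [Set.disjoint_left]
  rintro u ⟨_, _, h⟩ ⟨_, h', _⟩
  exact h h'

theorem disj_node (v : List (Fin 2)) :
    Disjoint ((Pattern.subtree (v ++ [0])).cover T) ((Pattern.subtree (v ++ [1])).cover T) := by
  rw [Set.disjoint_left]
  rintro u ⟨_, h⟩ ⟨_, h'⟩
  exact pre_disj v u h h'

theorem top_pre (p : Pattern 2) (u : List (Fin 2)) (h : u ∈ p.cover T) : p.top <+: u := by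
  cases p with
  | subtree v => exact h.2
  | context v w => exact h.2.1

variable {T lab}

theorem Sits.hole {e : Ex ℓ} {p : Pattern 2} (h : Sits T lab e p) :
    match p with
    | .subtree _ => True
    | .context v w => w = v ++ e.hole ∧ e.hole ≠ [] := by
  induction h with
  | leaf v h => trivial
  | node v l r _ _ h1 _ => trivial
  | app v w c t _ _ h1 _ => trivial
  | nodeL v e h0 _ _ => exact ⟨rfl, by simp [Ex.hole]⟩
  | nodeR v e h0 _ _ => exact ⟨rfl, by simp [Ex.hole]⟩
  | comp v w x c d _ _ h1 h2 =>
    refine ⟨?_, ?_⟩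
    · rw [h2.1, h1.1]; simp [Ex.hole]
    · simp only [Ex.hole]
      intro h
      exact h1.2 (List.append_eq_nil_iff.1 h).1

theorem Sits.valid {e : Ex ℓ} {p : Pattern 2} (h : Sits T lab e p) : p.Valid T := by
  have h1 := Sits.mem T lab h
  have h2 := h.hole
  cases p with
  | subtree v => exact h1
  | context v w =>
    refine ⟨h1.1, h1.2, ?_, ?_⟩
    · rw [h2.1]; exact List.prefix_append _ _
    · intro h
      have h3 := h2.1
      rw [h] at h3
      exact h2.2 (by simpa using h3)

theorem valid_nonempty {p : Pattern 2} (h : p.Valid T) : p.top ∈ p.cover T := by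
  cases p with
  | subtree v => exact ⟨h, List.prefix_rfl⟩
  | context v w =>
    refine ⟨h.1, List.prefix_rfl, ?_⟩
    intro hw
    exact h.2.2.2 (h.2.2.1.eq_of_length_le hw.length_le)

theorem shift_mem {v z x : List (Fin 2)} {p : Pattern 2} (hp : p.top = v ++ z) (h : v ++ x ∈ p.cover T) :
    ∃ y, x = z ++ y := by
  have := top_pre T p _ h
  rw [hp] at this
  obtain ⟨y, hy⟩ := this
  exact ⟨y, by simpa using hy.symm⟩

theorem Sits.rc {e : Ex ℓ} {p : Pattern 2} (h : Sits T lab e p) : ∀ x b,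
    (p.top ++ x ∈ p.cover T ∧ lab (p.top ++ x) = b) ↔ e.rc x b := by
  -- relative membership in a shifted subpattern
  have key : ∀ (e : Ex ℓ) (p : Pattern 2) (v z : List (Fin 2)), p.top = v ++ z →
      (∀ x b, (p.top ++ x ∈ p.cover T ∧ lab (p.top ++ x) = b) ↔ e.rc x b) → ∀ x b,
      ((v ++ x ∈ p.cover T ∧ lab (v ++ x) = b) ↔ ∃ y, x = z ++ y ∧ e.rc y b) := by
    intro e p v z hp he x b
    constructor
    · rintro ⟨h1, h2⟩
      obtain ⟨y, rfl⟩ := shift_mem hp h1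
      refine ⟨y, rfl, (he y b).1 ?_⟩
      rw [hp]
      simpa using ⟨h1, h2⟩
    · rintro ⟨y, rfl, h⟩
      have := (he y b).2 h
      rw [hp] at this
      simpa using this
  induction h with
  | leaf v hv h0 h1 =>
    intro x b
    have n0 : v ++ x ∉ (Pattern.subtree (v ++ [0])).cover T :=
      fun h => h0 (T.prefix_closed _ _ h.2 h.1)
    have n1 : v ++ x ∉ (Pattern.subtree (v ++ [1])).cover T :=
      fun h => h1 (T.prefix_closed _ _ h.2 h.1)
    simp only [Pattern.top, cover_node T v hv, n0, n1, Ex.rc, or_false, app_eq_left]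
    constructor
    · rintro ⟨rfl, h⟩; simpa using h
    · rintro ⟨rfl, h⟩; simpa using h
  | node v l r hl hr h1 h2 =>
    intro x b
    have hv := Sits.mem T lab (Sits.node v l r hl hr)
    have k1 := key _ _ v [0] rfl h1 x b
    have k2 := key _ _ v [1] rfl h2 x b
    simp only [Pattern.top, cover_node T v hv, Ex.rc, ← k1, ← k2, app_eq_left, or_and_right]
    constructor
    · rintro (⟨rfl, h⟩ | h)
      · left; simpa using h
      · right; exact h
    · rintro (⟨rfl, h⟩ | h)
      · left; simpa using h
      · right; exact h
  | app v w c t hc ht h1 h2 =>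
    intro x b
    have hw := hc.hole
    have k2 := key _ (.subtree w) v c.hole hw.1 h2 x b
    have k1 := h1 x b
    simp only [Pattern.top] at k1
    have hvw : v <+: w := by rw [hw.1]; exact List.prefix_append _ _
    simp only [Pattern.top, cover_app T v w hvw, Ex.rc, ← k2, ← k1, or_and_right]
  | nodeL v e h0 he h1 =>
    intro x b
    have hv := (Sits.mem T lab (Sits.nodeL v e h0 he)).1
    have k1 := key _ _ v [1] rfl h1 x b
    simp only [Pattern.top, cover_nodeL T v hv, Ex.rc, ← k1, app_eq_left, or_and_right]
    constructor
    · rintro (⟨rfl, h⟩ | h)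
      · left; simpa using h
      · right; exact h
    · rintro (⟨rfl, h⟩ | h)
      · left; simpa using h
      · right; exact h
  | nodeR v e h0 he h1 =>
    intro x b
    have hv := (Sits.mem T lab (Sits.nodeR v e h0 he)).1
    have k1 := key _ _ v [0] rfl h1 x b
    simp only [Pattern.top, cover_nodeR T v hv, Ex.rc, ← k1, app_eq_left, or_and_right]
    constructor
    · rintro (⟨rfl, h⟩ | h)
      · left; simpa using h
      · right; exact h
    · rintro (⟨rfl, h⟩ | h)
      · left; simpa using h
      · right; exact h
  | comp v w z c d hc hd h1 h2 =>
    intro x b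
    have hw := hc.hole
    have hz := hd.hole
    have k2 := key _ (.context w z) v c.hole hw.1 h2 x b
    have k1 := h1 x b
    simp only [Pattern.top] at k1
    have hvw : v <+: w := by rw [hw.1]; exact List.prefix_append _ _
    have hwz : w <+: z := by rw [hz.1]; exact List.prefix_append _ _
    simp only [Pattern.top, cover_comp T v w z hvw hwz, Ex.rc, ← k2, ← k1, or_and_right]

/-- What is recorded at every derived pattern. -/
def GG (T : PosTree 2) (lab : List (Fin 2) → Fin ℓ) (e : Ex ℓ) (p : Pattern 2)
    (S : Finset (Pattern 2)) : Prop :=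
  Sits T lab e p ∧ S = e.pats p.top

theorem der_one {e e1 : Ex ℓ} {p p1 : Pattern 2} {S1 : Finset (Pattern 2)} (v : List (Fin 2))
    (hs : Sits T lab e p) (hS : e.pats p.top = insert p S1) (h1 : Der T (GG T lab) e1 p1 S1)
    (hc : ∀ u, u ∈ p.cover T ↔ u = v ∨ u ∈ p1.cover T) (hv : v ∉ p1.cover T)
    (hd : e.dep = 1 + e1.dep) (hsub : e1.subs ⊆ e.subs) : Der T (GG T lab) e p (e.pats p.top) := by
  refine Der.mk e p _ v 1 (fun _ => e1) (fun _ => p1) (fun _ => S1) (fun _ => h1) (by omega)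
    ⟨hs, rfl⟩ ⟨_, valid_nonempty hs.valid⟩ ?_ ?_ ?_ ?_ (fun _ => by omega) (by omega) (fun _ => hsub)
  · intro q; rw [hS]; simp
  · intro u hu; simpa using (hc u).1 hu
  · intro _
    exact ⟨fun u hu => (hc u).2 (Or.inr hu), fun h => hv (h ((hc v).2 (Or.inl rfl)))⟩
  · intro i j hij; exact absurd (Subsingleton.elim i j) hij

theorem der_two {e e1 e2 : Ex ℓ} {p p1 p2 : Pattern 2} {S1 S2 : Finset (Pattern 2)}
    (v : List (Fin 2))
    (hs : Sits T lab e p) (hS : e.pats p.top = insert p (S1 ∪ S2))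
    (h1 : Der T (GG T lab) e1 p1 S1) (h2 : Der T (GG T lab) e2 p2 S2)
    (hc : ∀ u, u ∈ p.cover T → u = v ∨ u ∈ p1.cover T ∨ u ∈ p2.cover T)
    (hc1 : p1.cover T ⊆ p.cover T) (hc2 : p2.cover T ⊆ p.cover T)
    (hdis : Disjoint (p1.cover T) (p2.cover T))
    (hd : e.dep = 1 + max e1.dep e2.dep) (hsub : e1.subs ∪ e2.subs ⊆ e.subs) :
    Der T (GG T lab) e p (e.pats p.top) := by
  have n1 := (h1.sub _ h1.self_mem).1
  have n2 := (h2.sub _ h2.self_mem).1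
  have s1 : p1.cover T ⊂ p.cover T :=
    ⟨hc1, fun h => not_le_disj n2 hc2 subset_rfl subset_rfl (hdis.mono_left h)⟩
  have s2 : p2.cover T ⊂ p.cover T :=
    ⟨hc2, fun h => not_le_disj n1 subset_rfl hc1 subset_rfl (hdis.mono_right h)⟩
  refine Der.mk e p _ v 2 ![e1, e2] ![p1, p2] ![S1, S2] ?_ le_rfl
    ⟨hs, rfl⟩ ⟨_, valid_nonempty hs.valid⟩ ?_ ?_ ?_ ?_ ?_ (by omega) ?_
  · intro i; fin_cases i
    · exact h1
    · exact h2
  · intro q; rw [hS]; simp [Fin.exists_fin_two]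
  · intro u hu; simpa [Fin.exists_fin_two] using hc u hu
  · intro i; fin_cases i
    · exact s1
    · exact s2
  · intro i j hij; fin_cases i <;> fin_cases j
    · exact absurd rfl hij
    · exact hdis
    · exact hdis.symm
    · exact absurd rfl hij
  · intro i; fin_cases i
    · change e1.dep + 1 ≤ _; omega
    · change e2.dep + 1 ≤ _; omega
  · intro i; fin_cases i
    · exact Finset.union_subset_left hsub
    · exact Finset.union_subset_right hsub

theorem Sits.der {e : Ex ℓ} {p : Pattern 2} (h : Sits T lab e p) :
    Der T (GG T lab) e p (e.pats p.top) := by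
  induction h with
  | leaf v hv h0 h1 =>
    have hs := Sits.leaf (lab := lab) v hv h0 h1
    refine Der.mk _ _ _ v 0 Fin.elim0 Fin.elim0 Fin.elim0 (fun i => i.elim0) (by omega)
      ⟨hs, rfl⟩ ⟨_, valid_nonempty hs.valid⟩ ?_ ?_ (fun i => i.elim0) (fun i => i.elim0)
      (fun i => i.elim0) le_rfl (fun i => i.elim0)
    · intro q; simp [Ex.pats, Pattern.top]
    · intro u hu
      rcases (cover_node T v hv u).1 hu with h | h | h
      · exact Or.inl h
      · exact absurd (T.prefix_closed _ _ h.2 h.1) h0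
      · exact absurd (T.prefix_closed _ _ h.2 h.1) h1
  | node v l r hl hr h1 h2 =>
    have hs := Sits.node v l r hl hr
    have hv := Sits.mem T lab hs
    refine der_two v hs rfl h1 h2 (fun u hu => (cover_node T v hv u).1 hu) ?_ ?_ (disj_node T v)
      rfl ?_
    · exact fun u hu => (cover_node T v hv u).2 (Or.inr (Or.inl hu))
    · exact fun u hu => (cover_node T v hv u).2 (Or.inr (Or.inr hu))
    · exact Finset.subset_insert _ _
  | app v w c t hc ht h1 h2 =>
    have hs := Sits.app v w c t hc ht
    have hw := hc.hole
    have hvw : v <+: w := by rw [hw.1]; exact List.prefix_append _ _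
    refine der_two v hs ?_ h1 h2 (fun u hu => Or.inr ((cover_app T v w hvw u).1 hu)) ?_ ?_
      (disj_app T v w) rfl ?_
    · simp only [Ex.pats, Pattern.top, hw.1]
    · exact fun u hu => (cover_app T v w hvw u).2 (Or.inl hu)
    · exact fun u hu => (cover_app T v w hvw u).2 (Or.inr hu)
    · exact Finset.subset_insert _ _
  | nodeL v e h0 he h1 =>
    have hs := Sits.nodeL v e h0 he
    have hv := (Sits.mem T lab hs).1
    exact der_one v hs rfl h1 (cover_nodeL T v hv) (fun h => not_pre_self _ _ h.2) rfl
      (Finset.subset_insert _ _)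
  | nodeR v e h0 he h1 =>
    have hs := Sits.nodeR v e h0 he
    have hv := (Sits.mem T lab hs).1
    exact der_one v hs rfl h1 (cover_nodeR T v hv) (fun h => not_pre_self _ _ h.2) rfl
      (Finset.subset_insert _ _)
  | comp v w z c d hc hd h1 h2 =>
    have hs := Sits.comp v w z c d hc hd
    have hw := hc.hole
    have hz := hd.hole
    have hvw : v <+: w := by rw [hw.1]; exact List.prefix_append _ _
    have hwz : w <+: z := by rw [hz.1]; exact List.prefix_append _ _
    refine der_two v hs ?_ h1 h2 (fun u hu => Or.inr ((cover_comp T v w z hvw hwz u).1 hu)) ?_ ?_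
      (disj_comp T v w z) rfl ?_
    · simp only [Ex.pats, Pattern.top]
      rw [hz.1, hw.1]; simp
    · exact fun u hu => (cover_comp T v w z hvw hwz u).2 (Or.inl hu)
    · exact fun u hu => (cover_comp T v w z hvw hwz u).2 (Or.inr hu)
    · exact Finset.subset_insert _ _

/-- Translated patterns have translated covers. -/
theorem sh_cover (v₁ v₂ : List (Fin 2)) (q : Pattern 2) (x : List (Fin 2))
    (h : v₁ ++ x ∈ (q.sh v₁).cover T) (hx : v₂ ++ x ∈ T.nodes) : v₂ ++ x ∈ (q.sh v₂).cover T := by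
  cases q with
  | subtree u =>
    simp only [Pattern.sh, Pattern.cover, Set.mem_ofPred_eq, List.prefix_append_right_inj] at *
    exact ⟨hx, h.2⟩
  | context u w =>
    simp only [Pattern.sh, Pattern.cover, Set.mem_ofPred_eq, List.prefix_append_right_inj] at *
    exact ⟨hx, h.2⟩

theorem cover_nodes (q : Pattern 2) (u : List (Fin 2)) (h : u ∈ q.cover T) : u ∈ T.nodes := by
  cases q <;> exact h.1

theorem equiv_of_sits (P : Finset (Pattern 2)) (e : Ex ℓ) (p₁ p₂ : Pattern 2)
    (h1 : Sits T lab e p₁) (h2 : Sits T lab e p₂)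
    (hP1 : e.pats p₁.top ⊆ P) (hP2 : e.pats p₂.top ⊆ P)
    (hl1 : ∀ r ∈ P, r.cover T ⊆ p₁.cover T → r ∈ e.pats p₁.top)
    (hl2 : ∀ r ∈ P, r.cover T ⊆ p₂.cover T → r ∈ e.pats p₂.top) :
    Equivalent T lab P p₁ p₂ := by
  set v₁ := p₁.top with hv1
  set v₂ := p₂.top with hv2
  have hφ : ∀ x, v₂ ++ (v₁ ++ x).drop v₁.length = v₂ ++ x := by intro x; simp
  have hmem : ∀ x, v₁ ++ x ∈ p₁.cover T ↔ v₂ ++ x ∈ p₂.cover T := by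
    intro x
    constructor
    · intro h
      exact ((h2.rc x _).2 ((h1.rc x _).1 ⟨h, rfl⟩)).1
    · intro h
      exact ((h1.rc x _).2 ((h2.rc x _).1 ⟨h, rfl⟩)).1
  have himg : ∀ q : Pattern 2, (q.sh v₁).cover T ⊆ p₁.cover T → (q.sh v₂).cover T ⊆ p₂.cover T →
      (fun u : List (Fin 2) => v₂ ++ u.drop v₁.length) '' (q.sh v₁).cover T = (q.sh v₂).cover T := by
    intro q hq1 hq2
    ext y
    constructor
    · rintro ⟨u, hu, rfl⟩
      obtain ⟨x, rfl⟩ := top_pre T p₁ u (hq1 hu)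
      change v₂ ++ (v₁ ++ x).drop v₁.length ∈ _
      rw [hφ]
      exact sh_cover v₁ v₂ q x hu (cover_nodes _ _ ((hmem x).1 (hq1 hu)))
    · intro hy
      obtain ⟨x, rfl⟩ := top_pre T p₂ y (hq2 hy)
      exact ⟨v₁ ++ x, sh_cover v₂ v₁ q x hy (cover_nodes _ _ ((hmem x).2 (hq2 hy))), hφ x⟩
  have hp : ∀ v, e.pats v = (e.pats []).image (Pattern.sh v) := by
    intro v
    simpa using e.pats_sh v []
  refine ⟨fun u => v₂ ++ u.drop v₁.length, ⟨?_, ?_, ?_⟩, ?_, ?_, ?_, ?_⟩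
  · intro u hu
    obtain ⟨x, rfl⟩ := top_pre T p₁ u hu
    change v₂ ++ (v₁ ++ x).drop v₁.length ∈ _
    rw [hφ]
    exact (hmem x).1 hu
  · intro u hu u' hu' h
    obtain ⟨x, rfl⟩ := top_pre T p₁ u hu
    obtain ⟨x', rfl⟩ := top_pre T p₁ u' hu'
    change v₂ ++ (v₁ ++ x).drop v₁.length = v₂ ++ (v₁ ++ x').drop v₁.length at h
    rw [hφ, hφ] at h
    rw [List.append_cancel_left h]
  · intro y hy
    obtain ⟨x, rfl⟩ := top_pre T p₂ y hy
    exact ⟨v₁ ++ x, (hmem x).2 hy, hφ x⟩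
  · intro u hu
    obtain ⟨x, rfl⟩ := top_pre T p₁ u hu
    change lab (v₂ ++ (v₁ ++ x).drop v₁.length) = lab (v₁ ++ x)
    rw [hφ]
    exact ((h2.rc x _).2 ((h1.rc x _).1 ⟨hu, rfl⟩)).2
  · intro u hu w hw i
    obtain ⟨x, rfl⟩ := top_pre T p₁ u hu
    obtain ⟨y, rfl⟩ := top_pre T p₁ w hw
    change v₁ ++ y = v₁ ++ x ++ [i] ↔
      v₂ ++ (v₁ ++ y).drop v₁.length = v₂ ++ (v₁ ++ x).drop v₁.length ++ [i]
    rw [hφ, hφ]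
    simp
  · intro q hq hqp
    have := hl1 q hq hqp
    rw [hp, Finset.mem_image] at this
    obtain ⟨q0, hq0, rfl⟩ := this
    have hm : q0.sh v₂ ∈ e.pats v₂ := by rw [hp]; exact Finset.mem_image_of_mem _ hq0
    have hs := (h2.der.sub _ hm).2.1
    exact ⟨q0.sh v₂, hP2 hm, hs, himg q0 hqp hs⟩
  · intro q hq hqp
    have := hl2 q hq hqp
    rw [hp, Finset.mem_image] at this
    obtain ⟨q0, hq0, rfl⟩ := this
    have hm : q0.sh v₁ ∈ e.pats v₁ := by rw [hp]; exact Finset.mem_image_of_mem _ hq0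
    have hs := (h1.der.sub _ hm).2.1
    exact ⟨q0.sh v₁, hP1 hm, hs, himg q0 hs hqp⟩

/-- An expression for the whole tree gives a hierarchical definition. -/
theorem hier_of_sits (e : Ex ℓ) (h : Sits T lab e (.subtree [])) :
    ∃ P : Finset (Pattern 2), IsHierDef T P ∧ WidthLE T P 3 ∧ DepthLE T P e.dep ∧
      InequivLE T lab P e.subs.card := by
  classical
  have hd := h.der
  set P := e.pats (Pattern.subtree []).top with hP
  refine ⟨P, ⟨?_, hd.self_mem, hd.nested⟩, ?_, ?_, ?_⟩
  · intro p hp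
    obtain ⟨e', _, S', _, h2, _⟩ := hd.loc p hp
    exact h2.spec.1.valid
  · intro p hp
    obtain ⟨e', _, S', h1, h2, h3⟩ := hd.loc p hp
    exact h2.width P h1 h3
  · intro c hc hch
    exact (hd.depth c hc hch).trans (Nat.le_succ _)
  · let Q : Ex ℓ → Pattern 2 → Prop := fun e' p => p ∈ P ∧ Sits T lab e' p ∧
      e'.pats p.top ⊆ P ∧ ∀ r ∈ P, r.cover T ⊆ p.cover T → r ∈ e'.pats p.top
    have hQ : ∀ p ∈ P, ∃ e' ∈ e.subs, Q e' p := by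
      intro p hp
      obtain ⟨e', he', S', h1, h2, h3⟩ := hd.loc p hp
      obtain ⟨s1, rfl⟩ := h2.spec
      exact ⟨e', he', hp, s1, h1, h3⟩
    let R : Ex ℓ → Pattern 2 := fun e' => if h : ∃ p, Q e' p then h.choose else .subtree []
    have hR : ∀ e' p, Q e' p → Q e' (R e') := by
      intro e' p hp
      have hex : ∃ p, Q e' p := ⟨p, hp⟩
      simp only [R, dif_pos hex]
      exact hex.choose_spec
    refine ⟨(e.subs.filter (fun e' => ∃ p, Q e' p)).image R, ?_, ?_, ?_⟩
    · intro q hq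
      obtain ⟨e', he', rfl⟩ := Finset.mem_image.1 hq
      obtain ⟨p, hp⟩ := (Finset.mem_filter.1 he').2
      exact (hR e' p hp).1
    · exact Finset.card_image_le.trans (Finset.card_filter_le _ _)
    · intro p hp
      obtain ⟨e', he', hq⟩ := hQ p hp
      refine ⟨R e', Finset.mem_image_of_mem _ (Finset.mem_filter.2 ⟨he', p, hq⟩), ?_⟩
      have hr := hR e' p hq
      exact equiv_of_sits P e' p (R e') hq.2.1 hr.2.1 hq.2.2.1 hr.2.2.1 hq.2.2.2 hr.2.2.2

/-- The tree of a position tree. -/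
theorem exists_bt (hT : T.IsFullBinary) : ∀ (N : ℕ) (v : List (Fin 2)), v ∈ T.nodes →
    ((Pattern.subtree v).cover T).ncard ≤ N →
    ∃ t : BT ℓ, Sits T lab t.toE (.subtree v) ∧
      t.toE.wt ≤ ((Pattern.subtree v).cover T).ncard := by
  have hfin : ∀ v, ((Pattern.subtree v).cover T).Finite := fun v =>
    T.nodes.finite_toSet.subset (fun u hu => hu.1)
  have hpos : ∀ v ∈ T.nodes, 1 ≤ ((Pattern.subtree v).cover T).ncard := by
    intro v hv
    rw [Nat.succ_le_iff, Set.ncard_pos (hfin v)]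
    exact ⟨v, hv, List.prefix_rfl⟩
  intro N
  induction N with
  | zero => intro v hv h; have := hpos v hv; omega
  | succ N ih =>
    intro v hv h
    by_cases h0 : v ++ [0] ∈ T.nodes
    · have h1 := hT v hv 0 1 h0
      have hcov : (Pattern.subtree v).cover T = insert v
          ((Pattern.subtree (v ++ [0])).cover T ∪ (Pattern.subtree (v ++ [1])).cover T) := by
        ext u; rw [cover_node T v hv]; rfl
      have hcard : ((Pattern.subtree v).cover T).ncard =
          ((Pattern.subtree (v ++ [0])).cover T).ncard +
          ((Pattern.subtree (v ++ [1])).cover T).ncard + 1 := by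
        rw [hcov, Set.ncard_insert_of_notMem _ ((hfin _).union (hfin _)),
          Set.ncard_union_eq (disj_node T v) (hfin _) (hfin _)]
        rintro (h | h)
        · exact not_pre_self _ _ h.2
        · exact not_pre_self _ _ h.2
      obtain ⟨l, l1, l2⟩ := ih (v ++ [0]) h0 (by omega)
      obtain ⟨r, r1, r2⟩ := ih (v ++ [1]) h1 (by omega)
      exact ⟨.node (lab v) l r, .node v _ _ l1 r1, by simp only [BT.toE, Ex.wt]; omega⟩
    · have h1 : v ++ [1] ∉ T.nodes := fun h1 => h0 (hT v hv 1 0 h1)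
      exact ⟨.leaf (lab v), .leaf v hv h0 h1, by simpa [BT.toE, Ex.wt] using hpos v hv⟩

end
theorem exists_expr {ℓ : ℕ} (T : PosTree 2) (hT : T.IsFullBinary) (lab : List (Fin 2) → Fin ℓ)
    (n : ℕ) (hn : n = T.nodes.card) (hn2 : 2 ≤ n) (q : ℕ) (hq : 1 ≤ q)
    (hK : 6 * (ℓ + 1) + 1 ≤ 2 ^ q) :
    ∃ e : Ex ℓ, Sits T lab e (.subtree []) ∧ e.dep ≤ 24 * Nat.log 2 n ∧
      e.subs.card * Nat.log 2 n ≤ (112 * q + 4 * 2 ^ (2 * q)) * n := by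
  have hcov : ((Pattern.subtree ([] : List (Fin 2))).cover T).ncard = n := by
    have : (Pattern.subtree ([] : List (Fin 2))).cover T = (T.nodes : Set (List (Fin 2))) := by
      ext u; simp [Pattern.cover]
    rw [this, Set.ncard_coe_finset, hn]
  obtain ⟨t, t1, t2⟩ := exists_bt (lab := lab) hT n [] T.root_mem hcov.le
  rw [hcov] at t2
  have hL1 : 1 ≤ Nat.log 2 n := Nat.log_pos (by norm_num) hn2
  have hLn : Nat.log 2 n < n := Nat.log_lt_self 2 (by omega)
  have hlow : 2 ^ Nat.log 2 n ≤ n := Nat.pow_log_le_self 2 (by omega)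
  have hup : n < 2 ^ (Nat.log 2 n + 1) := Nat.lt_pow_succ_log_self (by norm_num) n
  generalize Nat.log 2 n = L at *
  obtain ⟨a, ha⟩ : ∃ a, a = L / (8 * q) := ⟨_, rfl⟩
  have ha1 : 8 * q * a ≤ L := by rw [ha]; exact Nat.mul_div_le L (8 * q)
  have ha2 : L < 8 * q * (a + 1) := by rw [ha]; exact Nat.lt_mul_div_succ L (by omega)
  have haL : 8 * a ≤ L := by nlinarith
  obtain ⟨X, x1, x2, x3⟩ := cluster' T lab (a + 1) (by omega) t
  have hnum : X.num ≤ 2 ^ (L + 4) := by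
    have e1 : 2 ^ (L + 4) = 8 * 2 ^ (L + 1) := by ring
    rw [e1]
    have : (a + 1) * X.num ≤ (a + 1) * (6 * n + 1) := by nlinarith
    have := Nat.le_of_mul_le_mul_left this (by omega)
    omega
  obtain ⟨e, e1, e2, e3⟩ := (balance T lab (a + 1) (L + 4)).1 X x1 hnum
  refine ⟨e, e1 _ (x2 _ t1), by omega, ?_⟩
  have hs := Ex.card_subs (2 * (a + 1)) e
  have b1 : X.num * L ≤ 56 * q * n := by
    have c1 : X.num * L ≤ X.num * (8 * q * (a + 1)) := Nat.mul_le_mul_left _ ha2.le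
    have c2 : (a + 1) * X.num ≤ 7 * n := by omega
    have c3 : 8 * q * ((a + 1) * X.num) ≤ 8 * q * (7 * n) := Nat.mul_le_mul_left _ c2
    nlinarith
  have b2 : (6 * (ℓ + 1) + 1) ^ (2 * (a + 1)) * L ≤ 4 * 2 ^ (2 * q) * n := by
    have c1 : (6 * (ℓ + 1) + 1) ^ (2 * (a + 1)) ≤ (2 ^ q) ^ (2 * (a + 1)) :=
      Nat.pow_le_pow_left hK _
    have c2 : (2 ^ q) ^ (2 * (a + 1)) ≤ 2 ^ (L / 4) * 2 ^ (2 * q) := by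
      rw [← pow_mul, ← pow_add]
      apply Nat.pow_le_pow_right (by norm_num)
      have : 2 * q * a ≤ L / 4 := by
        rw [Nat.le_div_iff_mul_le (by norm_num)]; nlinarith
      nlinarith
    have c3 : L ≤ 4 * 2 ^ (L / 4) := by
      have : L / 4 < 2 ^ (L / 4) := Nat.lt_two_pow_self
      omega
    have c4 : 2 ^ (L / 4) * 2 ^ (L / 4) ≤ n := by
      rw [← pow_add]
      exact (Nat.pow_le_pow_right (by norm_num) (by omega)).trans hlow
    calc (6 * (ℓ + 1) + 1) ^ (2 * (a + 1)) * L
        ≤ (2 ^ (L / 4) * 2 ^ (2 * q)) * (4 * 2 ^ (L / 4)) := Nat.mul_le_mul (c1.trans c2) c3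
      _ = 4 * 2 ^ (2 * q) * (2 ^ (L / 4) * 2 ^ (L / 4)) := by ring
      _ ≤ 4 * 2 ^ (2 * q) * n := Nat.mul_le_mul_left _ c4
  calc e.subs.card * L ≤ (2 * X.num + (6 * (ℓ + 1) + 1) ^ (2 * (a + 1))) * L :=
        Nat.mul_le_mul_right _ (by omega)
    _ = 2 * (X.num * L) + (6 * (ℓ + 1) + 1) ^ (2 * (a + 1)) * L := by ring
    _ ≤ 2 * (56 * q * n) + 4 * 2 ^ (2 * q) * n := by omega
    _ = _ := by ring

/-- Combinatorial form of Proposition 4.3: for every constant `ℓ` there exist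
constants `C` and `W` such that every full binary tree with `n ≥ 2` nodes whose
nodes are labelled from a set of `ℓ` labels admits a hierarchical definition of
width at most `W`, depth at most `C·log₂ n`, and with at most `C·n/log₂ n`
pairwise inequivalent patterns. -/
theorem stmt7 (ℓ : ℕ) (hℓ : 1 ≤ ℓ) :
    ∃ (C : ℝ) (W : ℕ), 0 < C ∧
      ∀ (T : PosTree 2), T.IsFullBinary →
        ∀ (label : List (Fin 2) → Fin ℓ) (n : ℕ),
          n = T.nodes.card → 2 ≤ n →
          ∃ P : Finset (Pattern 2), IsHierDef T P ∧ WidthLE T P W ∧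
            (∃ d : ℕ, (d : ℝ) ≤ C * Real.logb 2 n ∧ DepthLE T P d) ∧
            (∃ m : ℕ, (m : ℝ) ≤ C * n / Real.logb 2 n ∧ InequivLE T label P m) := by
  obtain ⟨q, hq, hK⟩ : ∃ q : ℕ, 1 ≤ q ∧ 6 * (ℓ + 1) + 1 ≤ 2 ^ q :=
    ⟨6 * (ℓ + 1) + 1, by omega, Nat.lt_two_pow_self.le⟩
  refine ⟨((2 * (112 * q + 4 * 2 ^ (2 * q)) + 24 : ℕ) : ℝ), 3, by positivity, ?_⟩
  intro T hT label n hn hn2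
  obtain ⟨e, h1, h2, h3⟩ := exists_expr T hT label n hn hn2 q hq hK
  obtain ⟨P, p1, p2, p3, p4⟩ := hier_of_sits e h1
  have hnpos : (0 : ℝ) < n := by exact_mod_cast (by omega : 0 < n)
  have hL1 : 1 ≤ Nat.log 2 n := Nat.log_pos (by norm_num) hn2
  have hlow : ((Nat.log 2 n : ℕ) : ℝ) ≤ Real.logb 2 n := by
    rw [Real.le_logb_iff_rpow_le (by norm_num) hnpos, Real.rpow_natCast]
    exact_mod_cast Nat.pow_log_le_self 2 (by omega : n ≠ 0)
  have hup : Real.logb 2 n ≤ 2 * ((Nat.log 2 n : ℕ) : ℝ) := by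
    have h : Real.logb 2 n ≤ ((Nat.log 2 n + 1 : ℕ) : ℝ) := by
      rw [Real.logb_le_iff_le_rpow (by norm_num) hnpos, Real.rpow_natCast]
      exact_mod_cast (Nat.lt_pow_succ_log_self (by norm_num : 1 < 2) n).le
    have h' : (1 : ℝ) ≤ ((Nat.log 2 n : ℕ) : ℝ) := by exact_mod_cast hL1
    push_cast at h
    linarith
  have hLr : (1 : ℝ) ≤ ((Nat.log 2 n : ℕ) : ℝ) := by exact_mod_cast hL1
  refine ⟨P, p1, p2, ⟨e.dep, ?_, p3⟩, ⟨e.subs.card, ?_, p4⟩⟩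
  · have a1 : (e.dep : ℝ) ≤ 24 * ((Nat.log 2 n : ℕ) : ℝ) := by exact_mod_cast h2
    have a2 : (24 : ℝ) ≤ ((2 * (112 * q + 4 * 2 ^ (2 * q)) + 24 : ℕ) : ℝ) := by
      exact_mod_cast (by omega)
    nlinarith
  · rw [le_div_iff₀ (by linarith)]
    have a1 : (e.subs.card : ℝ) * ((Nat.log 2 n : ℕ) : ℝ) ≤
        ((112 * q + 4 * 2 ^ (2 * q) : ℕ) : ℝ) * n := by exact_mod_cast h3
    have a2 : (e.subs.card : ℝ) * Real.logb 2 n ≤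
        (e.subs.card : ℝ) * (2 * ((Nat.log 2 n : ℕ) : ℝ)) :=
      mul_le_mul_of_nonneg_left hup (by positivity)
    have a3 : ((2 * (112 * q + 4 * 2 ^ (2 * q)) + 24 : ℕ) : ℝ) =
        2 * ((112 * q + 4 * 2 ^ (2 * q) : ℕ) : ℝ) + 24 := by push_cast; ring
    rw [a3]
    nlinarith
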